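/- Let K be a positive integer and suppose Φ ∈ ℝ^{M×N} satisfies the restricted isometry property of order K+1 with constant δ < 1/(√K + 1). Let x ∈ ℝ^N have support T with |T| = K and let y = Φx. Then every OMP trajectory started from S₀ = ∅ satisfies S_K = T, and every x̃ ∈ ℝ^N supported on S_K satisfying the normal equations ⟨φ_i, y − Φx̃⟩ = 0 for all i ∈ S_K equals x; that is, OMP exactly recovers x in K iterations. -/

import Mathlib

open Finset

/-- The Euclidean (ℓ²) norm of a vector in ℝⁿ. -/
noncomputable def l2norm {n : ℕ} (v : Fin n → ℝ) : ℝ := Real.sqrt (∑ i, v i ^ 2)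

/-- The Euclidean inner product on ℝᵐ. -/
noncomputable def dot {m : ℕ} (u v : Fin m → ℝ) : ℝ := ∑ k, u k * v k

/-- `x` has at most `s` nonzero entries. -/
noncomputable def sparse {n : ℕ} (s : ℕ) (x : Fin n → ℝ) : Prop :=
  (Finset.univ.filter (fun i => x i ≠ 0)).card ≤ s

/-- `Φ` satisfies the restricted isometry property of order `s` with constant `δ`. -/
noncomputable def RIP {M N : ℕ} (Φ : Matrix (Fin M) (Fin N) ℝ) (s : ℕ) (δ : ℝ) : Prop :=
  ∀ x : Fin N → ℝ, sparse s x →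
    (1 - δ) * l2norm x ^ 2 ≤ l2norm (Φ.mulVec x) ^ 2 ∧
    l2norm (Φ.mulVec x) ^ 2 ≤ (1 + δ) * l2norm x ^ 2

theorem aux_l2_sq {n : ℕ} (v : Fin n → ℝ) : l2norm v ^ 2 = ∑ i, v i ^ 2 :=
  Real.sq_sqrt (Finset.sum_nonneg fun _ _ => sq_nonneg _)

theorem aux_l2_nonneg {n : ℕ} (v : Fin n → ℝ) : 0 ≤ l2norm v := Real.sqrt_nonneg _

theorem aux_sparse {n : ℕ} (T : Finset (Fin n)) (s : ℕ) (hT : T.card ≤ s) (z : Fin n → ℝ)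
    (hz : ∀ i, z i ≠ 0 → i ∈ T) : sparse s z := by
  refine le_trans (Finset.card_le_card ?_) hT
  intro i hi
  exact hz i (Finset.mem_filter.1 hi).2

theorem aux_adj {M N : ℕ} (Φ : Matrix (Fin M) (Fin N) ℝ) (z : Fin N → ℝ) (r : Fin M → ℝ) :
    dot (Φ.mulVec z) r = ∑ i, z i * dot (fun k => Φ k i) r := by
  simp only [dot, Matrix.mulVec, dotProduct, Finset.sum_mul, Finset.mul_sum]
  rw [Finset.sum_comm]
  refine Finset.sum_congr rfl fun i _ => Finset.sum_congr rfl fun k _ => by ring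

theorem aux_lower {M N : ℕ} (K : ℕ) (Φ : Matrix (Fin M) (Fin N) ℝ) (δ : ℝ)
    (hRIP : RIP Φ (K + 1) δ) (T : Finset (Fin N)) (hT : T.card = K) (z : Fin N → ℝ)
    (hz : ∀ i, z i ≠ 0 → i ∈ T) (C : ℝ) (hC0 : 0 ≤ C)
    (hC : ∀ i ∈ T, |dot (fun k => Φ k i) (Φ.mulVec z)| ≤ C) :
    (1 - δ) * l2norm z ^ 2 ≤ C * (Real.sqrt K * l2norm z) := by
  have h1 := (hRIP z (aux_sparse T _ (by omega) z hz)).1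
  have h2 : l2norm (Φ.mulVec z) ^ 2 = ∑ i, z i * dot (fun k => Φ k i) (Φ.mulVec z) := by
    rw [← aux_adj, aux_l2_sq]
    exact Finset.sum_congr rfl fun i _ => sq _
  have h3 : ∑ i, z i * dot (fun k => Φ k i) (Φ.mulVec z)
      = ∑ i ∈ T, z i * dot (fun k => Φ k i) (Φ.mulVec z) := by
    symm
    apply Finset.sum_subset (Finset.subset_univ _)
    intro i _ hi
    have : z i = 0 := by
      by_contra h
      exact hi (hz i h)
    simp [this]
  have h4 : ∑ i ∈ T, z i * dot (fun k => Φ k i) (Φ.mulVec z) ≤ C * ∑ i ∈ T, |z i| := by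
    rw [Finset.mul_sum]
    refine Finset.sum_le_sum fun i hi => ?_
    calc _ ≤ |z i * dot (fun k => Φ k i) (Φ.mulVec z)| := le_abs_self _
      _ = |dot (fun k => Φ k i) (Φ.mulVec z)| * |z i| := by rw [abs_mul, mul_comm]
      _ ≤ C * |z i| := mul_le_mul_of_nonneg_right (hC i hi) (abs_nonneg _)
  have h5 : ∑ i ∈ T, |z i| ≤ Real.sqrt K * l2norm z := by
    refine abs_le_of_sq_le_sq' ?_ (mul_nonneg (Real.sqrt_nonneg _) (aux_l2_nonneg z)) |>.2
    rw [mul_pow, Real.sq_sqrt (Nat.cast_nonneg _), aux_l2_sq]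
    have := sq_sum_le_card_mul_sum_sq (s := T) (f := fun i => |z i|)
    rw [hT] at this
    refine this.trans (mul_le_mul_of_nonneg_left ?_ (Nat.cast_nonneg _))
    simp only [sq_abs]
    exact Finset.sum_le_sum_of_subset_of_nonneg (Finset.subset_univ _) fun _ _ _ => sq_nonneg _
  have := mul_le_mul_of_nonneg_left h5 hC0
  linarith

theorem aux_off {M N : ℕ} (K : ℕ) (Φ : Matrix (Fin M) (Fin N) ℝ) (δ : ℝ)
    (hRIP : RIP Φ (K + 1) δ) (T : Finset (Fin N)) (hT : T.card = K) (z : Fin N → ℝ)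
    (hz : ∀ i, z i ≠ 0 → i ∈ T) (j : Fin N) (hj : j ∉ T) (s : ℝ) :
    2 * (s * dot (fun k => Φ k j) (Φ.mulVec z)) ≤ δ * (l2norm z ^ 2 + s ^ 2) := by
  have hzj : z j = 0 := by
    by_contra h
    exact hj (hz j h)
  have hsp : ∀ a : ℝ, sparse (K + 1) (z + Pi.single j a) := by
    intro a
    refine aux_sparse (insert j T) _ (by rw [Finset.card_insert_of_notMem hj, hT]) _ ?_
    intro i hi
    by_cases hij : i = j
    · simp [hij]
    · exact Finset.mem_insert_of_mem (hz i (by simpa [Pi.single_apply, hij] using hi))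
  have hn : ∀ a : ℝ, l2norm (z + Pi.single j a) ^ 2 = l2norm z ^ 2 + a ^ 2 := by
    intro a
    rw [aux_l2_sq, aux_l2_sq]
    have : ∀ i, (z + Pi.single j a : Fin N → ℝ) i ^ 2 = z i ^ 2 + if i = j then a ^ 2 else 0 := by
      intro i
      by_cases hij : i = j
      · subst hij; simp [hzj]
      · simp [Pi.single_apply, hij]
    simp only [this, Finset.sum_add_distrib]
    simp
  have hP : ∀ a : ℝ, l2norm (Φ.mulVec (z + Pi.single j a)) ^ 2 =
      l2norm (Φ.mulVec z) ^ 2 + 2 * a * dot (fun k => Φ k j) (Φ.mulVec z)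
        + a ^ 2 * ∑ k, Φ k j ^ 2 := by
    intro a
    rw [aux_l2_sq, aux_l2_sq, dot, Finset.mul_sum, Finset.mul_sum, ← Finset.sum_add_distrib,
      ← Finset.sum_add_distrib]
    refine Finset.sum_congr rfl fun k _ => ?_
    rw [Matrix.mulVec_add, Pi.add_apply, Matrix.mulVec_single]
    simp
    ring
  have h1 := (hRIP _ (hsp s)).2
  have h2 := (hRIP _ (hsp (-s))).1
  rw [hP, hn] at h1 h2
  nlinarith

/-- Theorem 1, exact recovery of OMP in `K` steps, [Wang & Shim]:
if `Φ` has RIP of order `K+1` with constant `δ < 1/(√K+1)`, `x` is `K`-sparse with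
support `T` and `y = Φx`, then every OMP trajectory started from `S 0 = ∅`
(with residuals `y − Φ(xt m)` orthogonal to the selected columns, and `t m` a maximizer
of the absolute correlation) satisfies `S K = T`, and the least-squares solution of `y`
on `S K` is exactly `x`. -/
theorem stmt_11 {M N : ℕ} (K : ℕ) (hK : 0 < K)
    (Φ : Matrix (Fin M) (Fin N) ℝ) (δ : ℝ) (hδ0 : 0 < δ)
    (hδ : δ < 1 / (Real.sqrt K + 1)) (hRIP : RIP Φ (K + 1) δ)
    (x : Fin N → ℝ) (T : Finset (Fin N))
    (hT : ∀ i, x i ≠ 0 ↔ i ∈ T) (hTcard : T.card = K)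
    (y : Fin M → ℝ) (hy : y = Φ.mulVec x)
    (S : ℕ → Finset (Fin N)) (t : ℕ → Fin N) (xt : ℕ → Fin N → ℝ)
    (hS0 : S 0 = ∅)
    (hsupp : ∀ m < K, ∀ i, xt m i ≠ 0 → i ∈ S m)
    (horth : ∀ m < K, ∀ i ∈ S m, dot (fun k => Φ k i) (y - Φ.mulVec (xt m)) = 0)
    (hmax : ∀ m < K, ∀ i : Fin N,
      |dot (fun k => Φ k i) (y - Φ.mulVec (xt m))| ≤
        |dot (fun k => Φ k (t m)) (y - Φ.mulVec (xt m))|)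
    (hstep : ∀ m < K, S (m + 1) = insert (t m) (S m)) :
    S K = T ∧
    ∀ w : Fin N → ℝ, (∀ i, w i ≠ 0 → i ∈ S K) →
      (∀ i ∈ S K, dot (fun k => Φ k i) (y - Φ.mulVec w) = 0) → w = x := by
  have hsK : 0 ≤ Real.sqrt K := Real.sqrt_nonneg _
  have hδ1 : δ * (Real.sqrt K + 1) < 1 := by
    rwa [lt_div_iff₀ (by positivity)] at hδ
  have hpos : ∀ z : Fin N → ℝ, z ≠ 0 → 0 < l2norm z := by
    intro z hz
    obtain ⟨i, hi⟩ := Function.ne_iff.1 hz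
    refine Real.sqrt_pos.2 (Finset.sum_pos' (fun _ _ => sq_nonneg _) ⟨i, Finset.mem_univ _, ?_⟩)
    have hi2 : z i ≠ 0 := hi
    positivity
  have hres : ∀ w : Fin N → ℝ, y - Φ.mulVec w = Φ.mulVec (x - w) := by
    intro w
    rw [hy, Matrix.mulVec_sub]
  have hsub : ∀ (w : Fin N → ℝ) (A : Finset (Fin N)), A ⊆ T → (∀ i, w i ≠ 0 → i ∈ A) →
      ∀ i, (x - w) i ≠ 0 → i ∈ T := by
    intro w A hA hw i hi
    by_contra h
    have h1 : x i = 0 := by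
      by_contra h'
      exact h ((hT i).1 h')
    have h2 : w i = 0 := by
      by_contra h'
      exact h (hA (hw i h'))
    simp [h1, h2] at hi
  have main : ∀ m ≤ K, S m ⊆ T ∧ (S m).card = m := by
    intro m
    induction m with
    | zero => intro _; simp [hS0]
    | succ m ih =>
      intro hm
      have hmK : m < K := hm
      obtain ⟨hST, hSc⟩ := ih hmK.le
      have hz := hsub (xt m) (S m) hST (hsupp m hmK)
      have hM := hmax m hmK
      have hO := horth m hmK
      rw [hres] at hM hO
      set z := x - xt m with hzdef
      have hzne : z ≠ 0 := by
        obtain ⟨i, hiT, hiS⟩ : ∃ i ∈ T, i ∉ S m :=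
          Finset.exists_mem_notMem_of_card_lt_card (by omega)
        intro h0
        have h1 : z i = 0 := by rw [h0]; rfl
        have h2 : xt m i = 0 := by
          by_contra h'
          exact hiS (hsupp m hmK i h')
        rw [hzdef, Pi.sub_apply, h2, sub_zero] at h1
        exact (hT i).2 hiT h1
      have hl := hpos z hzne
      have key := aux_lower K Φ δ hRIP T hTcard z hz _ (abs_nonneg _) (fun i _ => hM i)
      have hnot : ¬ |dot (fun k => Φ k (t m)) (Φ.mulVec z)| ≤ δ * l2norm z := by
        intro hle
        have h1 := mul_le_mul_of_nonneg_right hle (mul_nonneg hsK hl.le)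
        have h2 : 0 < l2norm z ^ 2 := by positivity
        nlinarith
      have htT : t m ∈ T := by
        by_contra hj
        have h1 := aux_off K Φ δ hRIP T hTcard z hz _ hj (l2norm z)
        have h2 := aux_off K Φ δ hRIP T hTcard z hz _ hj (-l2norm z)
        apply hnot
        rw [abs_le]
        constructor <;> nlinarith
      have htS : t m ∉ S m := by
        intro h
        apply hnot
        rw [hO _ h, abs_zero]
        positivity
      rw [hstep m hmK, Finset.card_insert_of_notMem htS, hSc]
      exact ⟨Finset.insert_subset htT hST, rfl⟩
  have hSK : S K = T := Finset.eq_of_subset_of_card_le (main K le_rfl).1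
    (by rw [(main K le_rfl).2, hTcard])
  refine ⟨hSK, fun w hw ho => ?_⟩
  rw [hSK] at hw ho
  rw [hres] at ho
  have hz := hsub w T subset_rfl hw
  by_contra hne
  have hl := hpos (x - w) (fun h => hne (sub_eq_zero.1 h).symm)
  have key := aux_lower K Φ δ hRIP T hTcard _ hz 0 le_rfl
    (fun i hi => by rw [ho i hi, abs_zero])
  have h2 : 0 < l2norm (x - w) ^ 2 := by positivity
  nlinarith [mul_nonneg hδ0.le hsK]
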